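/- arXiv:2502.12063 — 2 statements merged into one kernel-verified Lean document; each statement's English description precedes it below -/
import Mathlib

section
/- Let n ≥ 2 be even, K ≥ 1, and let f_1, …, f_n: ℝ^d → ℝ be differentiable with average f := (1/n)·Σ_i f_i, and suppose f* := inf_w f(w) > −∞. Assume there are σ, L > 0 such that for all i ∈ [n] and all w, v ∈ ℝ^d, ‖∇f_i(w) − ∇f(w)‖₂ ≤ σ and ‖∇f_i(w) − ∇f_i(v)‖₂ ≤ L·‖w − v‖₂. Fix an initial point w^1 ∈ ℝ^d, a step size α > 0, sign vectors η^1, …, η^K ∈ {−1,+1}^n, and permutations π_1, …, π_K of [n] generated as follows: π_1 is arbitrary; for each epoch k, the iterates are w^{k,0} := w^k and w^{k,i} := w^{k,i−1} − α·∇f_{π_k(i)}(w^{k,i−1}) for i ∈ [n], with the gradients x_i^k := ∇f_{π_k(i)}(w^{k,i−1}) and w^{k+1} := w^{k,n}; and π_{k+1}(i) := π_k(τ_k(i)), where τ_k lists first, in increasing order, all i with η_i^k = +1 and then, in decreasing order, all i with η_i^k = −1. Suppose there is Ã > 0 such that for every k ∈ [K], max_{j∈[n]} ‖ Σ_{i=1}^j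 η_i^k·x_i^k ‖₂ ≤ 2·Ã·max_{i∈[n]} ‖x_i^k − x̄^k‖₂, where x̄^k := (1/n)·Σ_i x_i^k. Then with step size α = min{ 1/(16·L·(2n + Ã)) , ( 4·F_1/(42·L²·σ²·Ã²·n·K + 18·L²·n³·σ²) )^{1/3} }, where F_1 := f(w^1) − f*, the iterates satisfy (1/K)·Σ_{k=1}^K ‖∇f(w^k)‖₂² ≤ 9·(F_1·L·σ·Ã)^{2/3}/(nK)^{2/3} + ( (72·F_1·L·σ)^{2/3} + 64·F_1·L·(2 + Ã/n) )/K. -/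
open Finset

noncomputable section

/-- Solving the coupled recursion between the prefix deviations `P`, the gradient norms `g` and the
within-epoch drifts `Δ`. -/
theorem sum_sq_drift_le {K : ℕ} {N A L α σ : ℝ} (hN : 0 ≤ N) (hA : 0 ≤ A)
    (hL : 0 ≤ L) (hα : 0 ≤ α) (hstep : 16 * L * (2 * N + A) * α ≤ 1)
    {P g Δ : ℕ → ℝ} (hP0 : ∀ k, 0 ≤ P k) (hg0 : ∀ k, 0 ≤ g k) (hΔ0 : ∀ k, 0 ≤ Δ k)
    (hΔ : ∀ k < K, Δ k ≤ α * (P k + N * g k + N * L * Δ k))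
    (hP : ∀ k, k + 1 < K →
      P (k + 1) ≤ P k / 2 + A * σ + 2 * (N + A) * L * Δ k + N / 2 * g (k + 1))
    (hinit : P 0 ≤ N * σ) :
    ∑ k ∈ range K, (L * Δ k) ^ 2 ≤ (1 / 9) * ∑ k ∈ range K, g k ^ 2 +
      α ^ 2 * L ^ 2 * σ ^ 2 * (16 * A ^ 2 * K + 7 * N ^ 2) := by
  have hθ : 0 ≤ α * L := mul_nonneg hα hL
  have hθN : α * L * N ≤ 1 / 32 := by nlinarith [mul_nonneg hθ hA]
  have hΔ' : ∀ k < K, L * Δ k ≤ 32 / 31 * (α * L) * (P k + N * g k) := fun k hk => by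
    have h1 := mul_le_mul_of_nonneg_left (hΔ k hk) hL
    have h2 := mul_le_mul_of_nonneg_right hθN (mul_nonneg hL (hΔ0 k))
    nlinarith
  have hP' : ∀ k, k + 1 < K →
      P (k + 1) ≤ 2 / 3 * P k + A * σ + N * (g k / 6 + g (k + 1) / 2) := fun k hk => by
    have h1 := mul_le_mul_of_nonneg_left (hΔ' k (by omega)) (by positivity : 0 ≤ 2 * (N + A))
    have h2 : 2 * (N + A) * (α * L) ≤ 1 / 8 := by nlinarith [mul_nonneg hθ hN]
    have h3 : 0 ≤ P k + N * g k := add_nonneg (hP0 k) (mul_nonneg hN (hg0 k))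
    have h4 := mul_le_mul_of_nonneg_right h2 h3
    nlinarith [hP k hk, hP0 k, mul_nonneg hN (hg0 k)]
  have hPsq : ∀ k, k + 1 < K → P (k + 1) ^ 2 ≤ 2 / 3 * P k ^ 2 + 18 / 5 * (A * σ) ^ 2 +
      40 / 3 * N ^ 2 * (g k ^ 2 / 6 + g (k + 1) ^ 2 / 2) := fun k hk => by
    have h1 := pow_le_pow_left₀ (hP0 _) (hP' k hk) 2
    have h2 : ∀ x y z : ℝ, (2 / 3 * x + y + z) ^ 2 ≤ 2 / 3 * x ^ 2 + 18 / 5 * y ^ 2 + 20 * z ^ 2 :=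
      fun x y z => by nlinarith [sq_nonneg (x - 3 * y - 3 * z), sq_nonneg (y - 5 * z)]
    have h3 : (g k / 6 + g (k + 1) / 2) ^ 2 ≤ 2 / 3 * (g k ^ 2 / 6 + g (k + 1) ^ 2 / 2) := by
      nlinarith [sq_nonneg (g k - g (k + 1))]
    have h4 := h2 (P k) (A * σ) (N * (g k / 6 + g (k + 1) / 2))
    have h5 := mul_le_mul_of_nonneg_left h3 (by positivity : 0 ≤ 20 * N ^ 2)
    nlinarith
  have hsum : ∀ M, M < K → ∑ k ∈ range (M + 1), P k ^ 2 + 2 * P M ^ 2 ≤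
      3 * P 0 ^ 2 + 54 / 5 * (A * σ) ^ 2 * M +
        40 * N ^ 2 * (2 / 3 * ∑ k ∈ range (M + 1), g k ^ 2 - g M ^ 2 / 6) := by
    intro M
    induction M with
    | zero =>
      intro _
      have : 0 ≤ N ^ 2 * g 0 ^ 2 := by positivity
      simp
      nlinarith
    | succ M ih =>
      intro hM
      have h1 := ih (by omega)
      have h2 := hPsq M hM
      rw [sum_range_succ _ (M + 1), sum_range_succ _ (M + 1)]
      push_cast
      nlinarith
  rcases K with _ | M
  · simp; positivity
  have hS := hsum M (by omega)
  have hΔsq : ∀ k ∈ range (M + 1), (L * Δ k) ^ 2 ≤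
      (32 / 31) ^ 2 * (α * L) ^ 2 * (6 / 5 * P k ^ 2 + 6 * N ^ 2 * g k ^ 2) := fun k hk => by
    have h1 := pow_le_pow_left₀ (mul_nonneg hL (hΔ0 k)) (hΔ' k (mem_range.1 hk)) 2
    have h2 : (P k + N * g k) ^ 2 ≤ 6 / 5 * P k ^ 2 + 6 * N ^ 2 * g k ^ 2 := by
      nlinarith [sq_nonneg (P k - 5 * (N * g k))]
    have h3 := mul_le_mul_of_nonneg_left h2 (by positivity : 0 ≤ (32 / 31) ^ 2 * (α * L) ^ 2)
    nlinarith
  have hT := sum_le_sum hΔsq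
  rw [← mul_sum, sum_add_distrib, ← mul_sum, ← mul_sum] at hT
  set SP := ∑ k ∈ range (M + 1), P k ^ 2
  set G := ∑ k ∈ range (M + 1), g k ^ 2
  have hG : 0 ≤ G := sum_nonneg fun k _ => by positivity
  have hP00 : P 0 ^ 2 ≤ (N * σ) ^ 2 := pow_le_pow_left₀ (hP0 0) hinit 2
  have hSP : SP ≤ 3 * (N * σ) ^ 2 + 54 / 5 * (A * σ) ^ 2 * (M + 1) + 80 / 3 * N ^ 2 * G := by
    nlinarith [sq_nonneg (P M), mul_nonneg (sq_nonneg N) (sq_nonneg (g M)), sq_nonneg (A * σ)]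
  have hθN2 : (α * L * N) ^ 2 ≤ (1 / 32) ^ 2 := pow_le_pow_left₀ (by positivity) hθN 2
  refine hT.trans ?_
  have h1 := mul_le_mul_of_nonneg_left hSP
    (by positivity : 0 ≤ (32 / 31 : ℝ) ^ 2 * (α * L) ^ 2 * (6 / 5))
  have h2 := mul_le_mul_of_nonneg_right hθN2 hG
  have h3 : 0 ≤ (α * L * (N * σ)) ^ 2 := by positivity
  have h4 : 0 ≤ (α * L * (A * σ)) ^ 2 * (M + 1) := by positivity
  push_cast
  nlinarith

/-- The convergence rate resulting from the tuned step size. -/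
theorem rate_bound_of_step_size {N K F L σ A α S : ℝ} (hN : 0 < N) (hK : 0 < K) (hF : 0 < F)
    (hL : 0 < L) (hσ : 0 < σ) (hA : 0 < A)
    (hα : α = min (1 / (16 * L * (2 * N + A)))
      ((4 * F / (42 * L ^ 2 * σ ^ 2 * A ^ 2 * N * K + 18 * L ^ 2 * N ^ 3 * σ ^ 2)) ^ ((1 : ℝ) / 3)))
    (hS : S ≤ 9 / 4 * F / (α * N) +
      7 / 16 * α ^ 2 * (42 * L ^ 2 * σ ^ 2 * A ^ 2 * K + 18 * L ^ 2 * N ^ 2 * σ ^ 2)) :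
    1 / K * S ≤ 9 * (F * L * σ * A) ^ ((2 : ℝ) / 3) / (N * K) ^ ((2 : ℝ) / 3) +
      ((72 * F * L * σ) ^ ((2 : ℝ) / 3) + 64 * F * L * (2 + A / N)) / K := by
  set D := 42 * L ^ 2 * σ ^ 2 * A ^ 2 * N * K + 18 * L ^ 2 * N ^ 3 * σ ^ 2 with hD
  have hD0 : 0 < D := by positivity
  set a := (4 * F / D) ^ ((1 : ℝ) / 3) with ha
  have ha0 : 0 < a := by positivity
  have cube : ∀ x : ℝ, 0 ≤ x → (x ^ ((1 : ℝ) / 3)) ^ 3 = x := fun x hx => by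
    rw [← Real.rpow_natCast, ← Real.rpow_mul hx]; norm_num
  have cube2 : ∀ x : ℝ, 0 ≤ x → (x ^ ((2 : ℝ) / 3)) ^ 3 = x ^ 2 := fun x hx => by
    rw [← Real.rpow_natCast, ← Real.rpow_mul hx]; norm_num
  have ha3 : a ^ 3 * D = 4 * F := by
    rw [ha, cube _ (by positivity)]; field_simp
  set b := (F * L * σ * A) ^ ((2 : ℝ) / 3) with hb
  set r := (72 * F * L * σ) ^ ((2 : ℝ) / 3) with hr
  set q := (N * K) ^ ((1 : ℝ) / 3) with hq
  have hb0 : 0 < b := by positivity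
  have hr0 : 0 < r := by positivity
  have hq0 : 0 < q := by positivity
  have hb3 : b ^ 3 = (F * L * σ * A) ^ 2 := cube2 _ (by positivity)
  have hr3 : r ^ 3 = (72 * F * L * σ) ^ 2 := cube2 _ (by positivity)
  have hq3 : q ^ 3 = N * K := cube _ (by positivity)
  have hq2 : (N * K) ^ ((2 : ℝ) / 3) = q ^ 2 := by
    rw [hq, ← Real.rpow_natCast, ← Real.rpow_mul (by positivity)]; norm_num
  have hα0 : 0 < α := by rw [hα]; positivity
  have hαa : α ≤ a := hα ▸ min_le_right _ _
  have hinv : 1 / α ≤ 16 * L * (2 * N + A) + 1 / a := by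
    rcases min_choice (1 / (16 * L * (2 * N + A))) a with h | h
    · rw [hα, h, one_div_one_div]; linarith [one_div_pos.2 ha0]
    · rw [hα, h]; linarith [(by positivity : 0 ≤ 16 * L * (2 * N + A))]
  have hY : 4 * F / a ≤ 9 * b * q + N * r := by
    refine le_of_pow_le_pow_left₀ (n := 3) (by norm_num) (by positivity) ?_
    have h1 : (4 * F / a) ^ 3 = 16 * F ^ 2 * D := by
      rw [div_pow, div_eq_iff (by positivity)]
      linear_combination (-16 * F ^ 2) * ha3
    have h2 : 729 * (b ^ 3 * q ^ 3) + N ^ 3 * r ^ 3 ≤ (9 * b * q + N * r) ^ 3 := by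
      have : 0 ≤ 3 * (9 * b * q) ^ 2 * (N * r) + 3 * (9 * b * q) * (N * r) ^ 2 := by positivity
      linarith
    rw [h1]
    refine le_trans ?_ h2
    rw [hb3, hq3, hr3, hD]
    have h3 : 0 ≤ F ^ 2 * L ^ 2 * σ ^ 2 * A ^ 2 * N * K := by positivity
    have h4 : 0 ≤ F ^ 2 * L ^ 2 * σ ^ 2 * N ^ 3 := by positivity
    linarith
  have hS1 : S * N ≤ 9 / 4 * F * (1 / α) + 7 / 16 * α ^ 2 * D := by
    calc S * N ≤ _ := mul_le_mul_of_nonneg_right hS hN.le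
      _ = _ := by rw [hD]; field_simp
  have hS2 : S * N ≤ 36 * F * L * (2 * N + A) + 4 * F / a := by
    have h1 := mul_le_mul_of_nonneg_left hinv (by positivity : 0 ≤ 9 / 4 * F)
    have h2 : α ^ 2 * D ≤ 4 * F / a := by
      calc α ^ 2 * D ≤ a ^ 2 * D := by gcongr
        _ = 4 * F / a := by rw [eq_div_iff ha0.ne']; linarith
    have h3 : 9 / 4 * F * (1 / a) = 9 / 16 * (4 * F / a) := by ring
    linarith
  rw [hq2]
  have h5 : 9 * b / q ^ 2 = 9 * b * q / (N * K) := by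
    rw [← hq3]; field_simp
  rw [h5]
  have h6 : 9 * b * q / (N * K) + (r + 64 * F * L * (2 + A / N)) / K =
      (9 * b * q + N * r + 64 * F * L * (2 * N + A)) / (N * K) := by
    field_simp; ring
  have h7 : 1 / K * S = S * N / (N * K) := by field_simp
  rw [h6, h7]
  gcongr
  have : 0 ≤ F * L * (2 * N + A) := by positivity
  linarith

/-- The first `m` indices of `Fin n`. -/
def initialSegment (n m : ℕ) : Finset (Fin n) := univ.filter fun a => (a : ℕ) < m

theorem initialSegment_self (n : ℕ) : initialSegment n n = univ := by
  simp [initialSegment]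

theorem initialSegment_zero (n : ℕ) : initialSegment n 0 = ∅ := by
  simp [initialSegment]

theorem initialSegment_succ {n : ℕ} (i : Fin n) :
    initialSegment n (i + 1) = insert i (initialSegment n i) := by
  ext a
  simp [initialSegment, Fin.ext_iff]
  omega

theorem notMem_initialSegment {n : ℕ} (i : Fin n) : i ∉ initialSegment n i := by
  simp [initialSegment]

theorem initialSegment_eq_Iic {n : ℕ} (i : Fin n) : initialSegment n (i + 1) = Iic i := by
  ext a
  simp only [initialSegment, mem_filter, mem_univ, true_and, mem_Iic, Fin.le_def]
  omega

theorem norm_sum_le_card_mul {n : ℕ} {E : Type*} [SeminormedAddCommGroup E] (s : Finset (Fin n))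
    {u : Fin n → E} {c : ℝ} (hc : 0 ≤ c) (hu : ∀ i, ‖u i‖ ≤ c) : ‖∑ i ∈ s, u i‖ ≤ n * c := by
  refine (norm_sum_le_of_le s fun i _ => hu i).trans ?_
  rw [sum_const, nsmul_eq_mul]
  gcongr
  exact (card_le_univ _).trans_eq (Fintype.card_fin n)

/-- Initial segments of a thinned reordering, or their complements, are the elements of fixed sign
in an initial segment of the original order. -/
theorem exists_image_initialSegment {n s : ℕ} {η : Fin n → ℝ} {τ : Equiv.Perm (Fin n)}
    (hmem : ∀ a : Fin n, (a : ℕ) < s ↔ η (τ a) = 1)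
    (hinc : ∀ a b : Fin n, (a : ℕ) < s → (b : ℕ) < s → (a < b ↔ τ a < τ b))
    (hdec : ∀ a b : Fin n, s ≤ (a : ℕ) → s ≤ (b : ℕ) → (a < b ↔ τ b < τ a)) (m : ℕ) (hm : m ≤ n) :
    ∃ j ≤ n, (∀ a : Fin n, (a : ℕ) < m ↔ (τ a : ℕ) < j ∧ η (τ a) = 1) ∨
      (∀ a : Fin n, ¬ (a : ℕ) < m ↔ (τ a : ℕ) < j ∧ ¬ η (τ a) = 1) := by
  rcases le_or_gt m s with hms | hms
  · rcases m with _ | m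
    · exact ⟨0, by omega, Or.inl fun a => by simp⟩
    refine ⟨τ ⟨m, hm⟩ + 1, (τ ⟨m, hm⟩).isLt, Or.inl fun a => ?_⟩
    rw [← hmem, Nat.lt_succ_iff, Nat.lt_succ_iff]
    constructor
    · intro h
      have h1 : (a : ℕ) < s := by omega
      refine ⟨not_lt.1 fun h2 => ?_, h1⟩
      have := (hinc ⟨m, hm⟩ a hms h1).2 h2
      exact absurd (Fin.lt_def.1 this) (by simpa using h)
    · rintro ⟨h1, h2⟩
      refine not_lt.1 fun h3 => ?_
      have := (hinc ⟨m, hm⟩ a hms h2).1 (Fin.lt_def.2 h3)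
      exact absurd (Fin.lt_def.1 this) (not_lt.2 h1)
  · rcases hm.eq_or_lt with rfl | hmn
    · exact ⟨0, by omega, Or.inr fun a => by simp⟩
    refine ⟨τ ⟨m, hmn⟩ + 1, (τ ⟨m, hmn⟩).isLt, Or.inr fun a => ?_⟩
    rw [← hmem, Nat.lt_succ_iff, not_lt, not_lt]
    constructor
    · intro h
      have h1 : s ≤ (a : ℕ) := by omega
      refine ⟨not_lt.1 fun h2 => ?_, h1⟩
      have := (hdec a ⟨m, hmn⟩ h1 hms.le).2 h2
      exact absurd (Fin.lt_def.1 this) (by simpa using h)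
    · rintro ⟨h1, h2⟩
      refine not_lt.1 fun h3 => ?_
      have := (hdec a ⟨m, hmn⟩ h2 hms.le).1 (Fin.lt_def.2 h3)
      exact absurd (Fin.lt_def.1 this) (not_lt.2 h1)

/-- Prefix sums of a centered family after a thinned reordering. -/
theorem norm_sum_thinned_reorder_le {n s : ℕ} {E : Type*} [NormedAddCommGroup E] [NormedSpace ℝ E]
    {η : Fin n → ℝ} (hη : ∀ i, η i = 1 ∨ η i = -1) {τ : Equiv.Perm (Fin n)}
    (hmem : ∀ a : Fin n, (a : ℕ) < s ↔ η (τ a) = 1)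
    (hinc : ∀ a b : Fin n, (a : ℕ) < s → (b : ℕ) < s → (a < b ↔ τ a < τ b))
    (hdec : ∀ a b : Fin n, s ≤ (a : ℕ) → s ≤ (b : ℕ) → (a < b ↔ τ b < τ a))
    (v : Fin n → E) (hv : ∑ i, v i = 0) (c : E) {A B : ℝ}
    (hA : ∀ j ≤ n, ‖∑ i ∈ initialSegment n j, v i‖ ≤ A)
    (hB : ∀ j ≤ n, ‖∑ i ∈ initialSegment n j, η i • (v i + c)‖ ≤ B) (m : ℕ) (hm : m ≤ n) :
    ‖∑ a ∈ initialSegment n m, v (τ a)‖ ≤ A / 2 + B / 2 + n / 2 * ‖c‖ := by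
  obtain ⟨j, hj, h⟩ := exists_image_initialSegment hmem hinc hdec m hm
  have hsplit : ∃ ε : ℝ, |ε| = 1 ∧ ∑ a ∈ initialSegment n m, v (τ a) =
      (1 / 2 : ℝ) • (ε • ∑ i ∈ initialSegment n j, v i + ∑ i ∈ initialSegment n j, η i • v i) := by
    rcases h with h | h
    · refine ⟨1, by simp, ?_⟩
      have : ∑ a ∈ initialSegment n m, v (τ a) = ∑ i : Fin n, if (i : ℕ) < j ∧ η i = 1 then v i else 0 := by
        rw [initialSegment, sum_filter, ← Equiv.sum_comp τ fun i : Fin n => if (i : ℕ) < j ∧ η i = 1 then v i else 0]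
        simp only [h]
      rw [this, one_smul, ← sum_add_distrib, smul_sum, initialSegment, sum_filter]
      refine sum_congr rfl fun i _ => ?_
      by_cases hi : (i : ℕ) < j
      · rcases hη i with h1 | h1
        · simp only [hi, h1, and_self, if_true]; module
        · simp only [hi, h1, true_and, if_true]; norm_num
      · simp [hi]
    · refine ⟨-1, by simp, ?_⟩
      have : ∑ a ∈ initialSegment n m, v (τ a) =
          ∑ i : Fin n, -(if (i : ℕ) < j ∧ ¬ η i = 1 then v i else 0) := by
        have h0 : ∑ a, v (τ a) = 0 := by rw [Equiv.sum_comp τ v, hv]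
        rw [← sum_filter_add_sum_filter_not univ (fun a : Fin n => (a : ℕ) < m)] at h0
        rw [initialSegment, eq_neg_of_add_eq_zero_left h0, sum_filter, sum_neg_distrib,
          ← Equiv.sum_comp τ (fun i : Fin n => if (i : ℕ) < j ∧ ¬ η i = 1 then v i else 0)]
        simp only [h]
      rw [this, smul_sum, ← sum_add_distrib, smul_sum, initialSegment, sum_filter]
      refine sum_congr rfl fun i _ => ?_
      by_cases hi : (i : ℕ) < j
      · rcases hη i with h1 | h1
        · simp [hi, h1]
        · have h2 : ¬ η i = 1 := by rw [h1]; norm_num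
          simp only [hi, h2, not_false_eq_true, and_self, if_true]
          rw [h1]; module
      · simp [hi]
  obtain ⟨ε, hε, heq⟩ := hsplit
  have hηv : ∑ i ∈ initialSegment n j, η i • v i =
      ∑ i ∈ initialSegment n j, η i • (v i + c) - ∑ i ∈ initialSegment n j, η i • c := by
    rw [← sum_sub_distrib]
    exact sum_congr rfl fun i _ => by module
  have hηc : ‖∑ i ∈ initialSegment n j, η i • c‖ ≤ n * ‖c‖ :=
    norm_sum_le_card_mul _ (norm_nonneg c) fun i => by
      rcases hη i with h1 | h1 <;> simp [h1]
  rw [heq, hηv, norm_smul]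
  have h1 := norm_add_le (ε • ∑ i ∈ initialSegment n j, v i)
    (∑ i ∈ initialSegment n j, η i • (v i + c) - ∑ i ∈ initialSegment n j, η i • c)
  have h2 := norm_sub_le (∑ i ∈ initialSegment n j, η i • (v i + c))
    (∑ i ∈ initialSegment n j, η i • c)
  rw [norm_smul, Real.norm_eq_abs, hε, one_mul] at h1
  have h3 : ‖(1 / 2 : ℝ)‖ = 1 / 2 := by norm_num
  rw [h3]
  linarith [hA j hj, hB j hj]

/-- The descent lemma for functions with Lipschitz gradient. -/
theorem le_add_inner_gradient_add_sq {E : Type*} [NormedAddCommGroup E] [InnerProductSpace ℝ E]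
    [CompleteSpace E] {f : E → ℝ} (hf : Differentiable ℝ f) {L : ℝ}
    (hL : ∀ w v, ‖gradient f w - gradient f v‖ ≤ L * ‖w - v‖) (x v : E) :
    f (x + v) ≤ f x + inner ℝ (gradient f x) v + L / 2 * ‖v‖ ^ 2 := by
  set φ : ℝ → ℝ := fun t => f (x + t • v) - t * inner ℝ (gradient f x) v - L / 2 * ‖v‖ ^ 2 * t ^ 2
  have hφ : ∀ t, HasDerivAt φ (inner ℝ (gradient f (x + t • v) - gradient f x) v -
      L * ‖v‖ ^ 2 * t) t := fun t => by
    have h1 : HasDerivAt (fun t : ℝ => x + t • v) v t := by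
      simpa using ((hasDerivAt_id t).smul_const v).const_add x
    have h2 : HasDerivAt (fun t : ℝ => f (x + t • v)) (inner ℝ (gradient f (x + t • v)) v) t := by
      rw [inner_gradient_left]
      exact (hf _).hasFDerivAt.comp_hasDerivAt t h1
    have h3 := (h2.sub ((hasDerivAt_id t).mul_const (inner ℝ (gradient f x) v))).sub
      ((hasDerivAt_pow 2 t).const_mul (L / 2 * ‖v‖ ^ 2))
    refine h3.congr_deriv ?_
    rw [inner_sub_left]
    norm_num
    ring
  have hanti : AntitoneOn φ (Set.Ici 0) := by
    refine antitoneOn_of_deriv_nonpos (convex_Ici 0)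
      (fun t _ => (hφ t).continuousAt.continuousWithinAt)
      (fun t _ => (hφ t).differentiableAt.differentiableWithinAt) fun t ht => ?_
    rw [interior_Ici, Set.mem_Ioi] at ht
    rw [(hφ t).deriv]
    have h1 := real_inner_le_norm (gradient f (x + t • v) - gradient f x) v
    have h2 := hL (x + t • v) x
    rw [add_sub_cancel_left, norm_smul, Real.norm_eq_abs, abs_of_pos ht] at h2
    have h3 := mul_le_mul_of_nonneg_right h2 (norm_nonneg v)
    nlinarith
  have h01 := hanti (Set.mem_Ici.2 le_rfl) (Set.mem_Ici.2 zero_le_one) zero_le_one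
  simp only [φ, one_smul, zero_smul, add_zero] at h01
  linarith

theorem descent_of_inexact_gradient {E : Type*} [NormedAddCommGroup E] [InnerProductSpace ℝ E]
    [CompleteSpace E] {f : E → ℝ} (hf : Differentiable ℝ f) {L : ℝ}
    (hL : ∀ w v, ‖gradient f w - gradient f v‖ ≤ L * ‖w - v‖) (x g : E) {β ε : ℝ} (hβ : 0 ≤ β)
    (hβL : β * L ≤ 1) (hg : ‖gradient f x - g‖ ≤ ε) :
    f (x - β • g) ≤ f x - β / 2 * ‖gradient f x‖ ^ 2 + β / 2 * ε ^ 2 := by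
  have h1 := le_add_inner_gradient_add_sq hf hL x (-(β • g))
  rw [← sub_eq_add_neg, inner_neg_right, real_inner_smul_right, norm_neg, norm_smul,
    Real.norm_eq_abs, abs_of_nonneg hβ] at h1
  have h2 := norm_sub_sq_real (gradient f x) g
  have h3 := pow_le_pow_left₀ (norm_nonneg _) hg 2
  have h5 := mul_le_mul_of_nonneg_left (h2.symm.trans_le h3) hβ
  have h6 := mul_le_mul_of_nonneg_left hβL (mul_nonneg hβ (sq_nonneg ‖g‖))
  nlinarith

section Epoch

variable {E : Type*} [NormedAddCommGroup E] {n : ℕ}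

/-- The largest distance of the iterates of an epoch from its starting point. -/
def epochDrift (x : Fin (n + 1) → E) : ℝ := ⨆ i, ‖x i - x 0‖

/-- The largest prefix sum, in the order `p`, of the centered gradients at `w`. -/
def prefixDeviation (G : Fin n → E → E) (Gb : E → E) (p : Equiv.Perm (Fin n))
    (w : E) : ℝ :=
  ⨆ m : Fin (n + 1), ‖∑ a ∈ initialSegment n m, (G (p a) w - Gb w)‖

theorem norm_sub_le_epochDrift (x : Fin (n + 1) → E) (i : Fin (n + 1)) :
    ‖x i - x 0‖ ≤ epochDrift x :=
  le_ciSup (f := fun i => ‖x i - x 0‖) (Set.finite_range _).bddAbove i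

theorem epochDrift_nonneg (x : Fin (n + 1) → E) : 0 ≤ epochDrift x :=
  (norm_nonneg _).trans (norm_sub_le_epochDrift x 0)

theorem norm_sum_le_prefixDeviation (G : Fin n → E → E) (Gb : E → E) (p : Equiv.Perm (Fin n))
    (w : E) (m : ℕ) (hm : m ≤ n) :
    ‖∑ a ∈ initialSegment n m, (G (p a) w - Gb w)‖ ≤ prefixDeviation G Gb p w :=
  le_ciSup (f := fun m : Fin (n + 1) => ‖∑ a ∈ initialSegment n m, (G (p a) w - Gb w)‖)
    (Set.finite_range _).bddAbove ⟨m, Nat.lt_succ_of_le hm⟩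

theorem prefixDeviation_nonneg (G : Fin n → E → E) (Gb : E → E) (p : Equiv.Perm (Fin n))
    (w : E) : 0 ≤ prefixDeviation G Gb p w :=
  (norm_nonneg _).trans (norm_sum_le_prefixDeviation G Gb p w 0 (Nat.zero_le n))

theorem prefixDeviation_le {G : Fin n → E → E} {Gb : E → E} {σ : ℝ} (hσ : 0 ≤ σ)
    (hnoise : ∀ i w, ‖G i w - Gb w‖ ≤ σ) (p : Equiv.Perm (Fin n)) (w : E) :
    prefixDeviation G Gb p w ≤ n * σ :=
  ciSup_le fun _ => norm_sum_le_card_mul _ hσ fun a => hnoise (p a) w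

variable [NormedSpace ℝ E]

theorem iterate_eq_sub_sum {x : Fin (n + 1) → E} {X : Fin n → E} {α : ℝ}
    (hx : ∀ i : Fin n, x i.succ = x i.castSucc - α • X i) (i : Fin (n + 1)) :
    x i = x 0 - α • ∑ a ∈ initialSegment n i, X a := by
  induction i using Fin.induction with
  | zero => simp [initialSegment_zero]
  | succ i ih =>
    rw [hx, ih, Fin.val_succ, initialSegment_succ, sum_insert (notMem_initialSegment i),
      Fin.val_castSucc]
    module

theorem norm_mean_sub_le {G : Fin n → E → E} {Gb : E → E} {L : ℝ} (hL : 0 ≤ L) (hn : 0 < n)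
    (hGb : ∀ w, Gb w = (n : ℝ)⁻¹ • ∑ i, G i w)
    (hlip : ∀ i w v, ‖G i w - G i v‖ ≤ L * ‖w - v‖) (p : Equiv.Perm (Fin n))
    (w : E) (y : Fin n → E) {c : ℝ} (hc : 0 ≤ c) (hy : ∀ i, ‖w - y i‖ ≤ c) :
    ‖Gb w - (n : ℝ)⁻¹ • ∑ i, G (p i) (y i)‖ ≤ L * c := by
  have hn' : (0 : ℝ) < n := Nat.cast_pos.2 hn
  rw [hGb, ← Equiv.sum_comp p, ← smul_sub, ← sum_sub_distrib, norm_smul, norm_inv,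
    Real.norm_natCast, inv_mul_le_iff₀ hn']
  refine norm_sum_le_card_mul _ (mul_nonneg hL hc) fun i => (hlip _ _ _).trans ?_
  gcongr
  exact hy i

theorem lipschitz_mean {G : Fin n → E → E} {Gb : E → E} {L : ℝ} (hL : 0 ≤ L) (hn : 0 < n)
    (hGb : ∀ w, Gb w = (n : ℝ)⁻¹ • ∑ i, G i w)
    (hlip : ∀ i w v, ‖G i w - G i v‖ ≤ L * ‖w - v‖) (w v : E) :
    ‖Gb w - Gb v‖ ≤ L * ‖w - v‖ := by
  rw [hGb v]
  exact norm_mean_sub_le hL hn hGb hlip (Equiv.refl _) w (fun _ => v) (norm_nonneg _) fun _ => le_rfl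

theorem epochDrift_le {G : Fin n → E → E} {Gb : E → E} {L α : ℝ} (hL : 0 ≤ L) (hα : 0 ≤ α)
    (hlip : ∀ i w v, ‖G i w - G i v‖ ≤ L * ‖w - v‖) (p : Equiv.Perm (Fin n))
    {x : Fin (n + 1) → E}
    (hx : ∀ i : Fin n, x i.succ = x i.castSucc - α • G (p i) (x i.castSucc)) :
    epochDrift x ≤ α * (prefixDeviation G Gb p (x 0) + n * ‖Gb (x 0)‖ + n * L * epochDrift x) := by
  refine ciSup_le fun i => ?_
  rw [iterate_eq_sub_sum hx i, sub_sub_cancel_left, norm_neg, norm_smul, Real.norm_eq_abs,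
    abs_of_nonneg hα]
  gcongr
  have hsplit : ∑ a ∈ initialSegment n i, G (p a) (x a.castSucc) =
      ∑ a ∈ initialSegment n i, (G (p a) (x 0) - Gb (x 0)) + ∑ a ∈ initialSegment n i, Gb (x 0) +
        ∑ a ∈ initialSegment n i, (G (p a) (x a.castSucc) - G (p a) (x 0)) := by
    rw [← sum_add_distrib, ← sum_add_distrib]
    exact sum_congr rfl fun a _ => by abel
  rw [hsplit]
  refine norm_add₃_le.trans (add_le_add_three ?_ ?_ ?_)
  · exact norm_sum_le_prefixDeviation G Gb p (x 0) i i.is_le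
  · exact norm_sum_le_card_mul _ (norm_nonneg _) fun _ => le_rfl
  · rw [mul_assoc]
    refine norm_sum_le_card_mul _ (mul_nonneg hL (epochDrift_nonneg x)) fun a => ?_
    refine (hlip _ _ _).trans ?_
    gcongr
    exact norm_sub_le_epochDrift x _

/-- One epoch of thinned reordering halves the prefix deviation, up to controlled errors. -/
theorem prefixDeviation_thinned_reorder_le {G : Fin n → E → E} {Gb : E → E} {L σ A : ℝ}
    (hL : 0 ≤ L) (hA : 0 ≤ A) (hn : 0 < n)
    (hGb : ∀ w, Gb w = (n : ℝ)⁻¹ • ∑ i, G i w)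
    (hnoise : ∀ i w, ‖G i w - Gb w‖ ≤ σ)
    (hlip : ∀ i w v, ‖G i w - G i v‖ ≤ L * ‖w - v‖) {p p' : Equiv.Perm (Fin n)}
    (x : Fin (n + 1) → E) {X : Fin n → E} (hX : ∀ i, X i = G (p i) (x i.castSucc))
    {η : Fin n → ℝ} (hη : ∀ i, η i = 1 ∨ η i = -1) {τ : Equiv.Perm (Fin n)} {s : ℕ}
    (hmem : ∀ a : Fin n, (a : ℕ) < s ↔ η (τ a) = 1)
    (hinc : ∀ a b : Fin n, (a : ℕ) < s → (b : ℕ) < s → (a < b ↔ τ a < τ b))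
    (hdec : ∀ a b : Fin n, s ≤ (a : ℕ) → s ≤ (b : ℕ) → (a < b ↔ τ b < τ a))
    (hp' : ∀ i, p' i = p (τ i))
    (hdisc : (⨆ j : Fin n, ‖∑ i ∈ Iic j, η i • X i‖) ≤
      2 * A * ⨆ i, ‖X i - (n : ℝ)⁻¹ • ∑ i', X i'‖) :
    prefixDeviation G Gb p' (x (Fin.last n)) ≤ prefixDeviation G Gb p (x 0) / 2 + A * σ +
      2 * (n + A) * L * epochDrift x + n / 2 * ‖Gb (x (Fin.last n))‖ := by
  set Δ := epochDrift x
  have hΔ : 0 ≤ Δ := epochDrift_nonneg x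
  have hLΔ : 0 ≤ L * Δ := mul_nonneg hL hΔ
  have hdrift : ∀ i, ‖x i - x 0‖ ≤ Δ := norm_sub_le_epochDrift x
  set w := x (Fin.last n)
  have : Nonempty (Fin n) := ⟨⟨0, hn⟩⟩
  have hgrad : ∀ i y, ‖y - x 0‖ ≤ Δ → ‖G i y - G i (x 0)‖ ≤ L * Δ := fun i y hy =>
    (hlip i y (x 0)).trans (mul_le_mul_of_nonneg_left hy hL)
  have hmean : ‖Gb w - Gb (x 0)‖ ≤ L * Δ :=
    (lipschitz_mean hL hn hGb hlip w (x 0)).trans (mul_le_mul_of_nonneg_left (hdrift _) hL)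
  have hrange : (⨆ i, ‖X i - (n : ℝ)⁻¹ • ∑ i', X i'‖) ≤ σ + 2 * (L * Δ) := by
    refine ciSup_le fun i => ?_
    have h1 : ‖Gb (x 0) - (n : ℝ)⁻¹ • ∑ i', X i'‖ ≤ L * Δ := by
      simp only [hX]
      refine norm_mean_sub_le hL hn hGb hlip p _ _ hΔ fun i => ?_
      rw [norm_sub_rev]
      exact hdrift _
    have h2 := hgrad (p i) _ (hdrift i.castSucc)
    rw [← hX] at h2
    have h3 : X i - (n : ℝ)⁻¹ • ∑ i', X i' = (X i - G (p i) (x 0)) +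
        (G (p i) (x 0) - Gb (x 0)) + (Gb (x 0) - (n : ℝ)⁻¹ • ∑ i', X i') := by abel
    rw [h3]
    refine norm_add₃_le.trans ?_
    linarith [hnoise (p i) (x 0)]
  have hsigned : ∀ j ≤ n, ‖∑ i ∈ initialSegment n j, η i • X i‖ ≤ 2 * A * (σ + 2 * (L * Δ)) := by
    have hbound := hdisc.trans (mul_le_mul_of_nonneg_left hrange (by positivity : 0 ≤ 2 * A))
    rintro (_ | j) hj
    · rw [initialSegment_zero, sum_empty, norm_zero]
      exact (Real.iSup_nonneg fun _ => norm_nonneg _).trans hbound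
    · refine le_trans ?_ hbound
      rw [initialSegment_eq_Iic ⟨j, hj⟩]
      exact le_ciSup (f := fun j : Fin n => ‖∑ i ∈ Iic j, η i • X i‖)
        (Set.finite_range _).bddAbove ⟨j, hj⟩
  refine ciSup_le fun m => ?_
  simp only [hp']
  have hkey := norm_sum_thinned_reorder_le hη hmem hinc hdec (fun i => G (p i) w - Gb w)
    (A := prefixDeviation G Gb p (x 0) + n * (2 * (L * Δ)))
    (B := 2 * A * (σ + 2 * (L * Δ)) + n * (2 * (L * Δ))) ?_ (Gb w) ?_ ?_ m m.is_le
  · refine hkey.trans (le_of_eq ?_)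
    ring
  · rw [sum_sub_distrib, Equiv.sum_comp p fun i => G i w, hGb w, sum_const, card_univ,
      Fintype.card_fin, ← Nat.cast_smul_eq_nsmul ℝ, smul_inv_smul₀ (by positivity), sub_self]
  · intro j hj
    have h1 : ∑ i ∈ initialSegment n j, (G (p i) w - Gb w) =
        ∑ i ∈ initialSegment n j, (G (p i) (x 0) - Gb (x 0)) +
        ∑ i ∈ initialSegment n j, ((G (p i) w - G (p i) (x 0)) - (Gb w - Gb (x 0))) := by
      rw [← sum_add_distrib]
      exact sum_congr rfl fun a _ => by abel
    rw [h1]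
    refine (norm_add_le _ _).trans (add_le_add (norm_sum_le_prefixDeviation G Gb p _ j hj) ?_)
    refine norm_sum_le_card_mul _ (by positivity) fun i => (norm_sub_le _ _).trans ?_
    linarith [hgrad (p i) w (hdrift _)]
  · intro j hj
    have h1 : ∑ i ∈ initialSegment n j, η i • (G (p i) w - Gb w + Gb w) =
        ∑ i ∈ initialSegment n j, η i • X i +
        ∑ i ∈ initialSegment n j, η i • ((G (p i) w - G (p i) (x 0)) - (X i - G (p i) (x 0))) := by
      rw [← sum_add_distrib]
      exact sum_congr rfl fun a _ => by module
    rw [h1]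
    refine (norm_add_le _ _).trans (add_le_add (hsigned j hj) ?_)
    refine norm_sum_le_card_mul _ (by positivity) fun i => ?_
    have h2 : ‖η i‖ = 1 := by rcases hη i with h | h <;> simp [h]
    rw [norm_smul, h2, one_mul]
    refine (norm_sub_le _ _).trans ?_
    rw [hX]
    linarith [hgrad (p i) w (hdrift _), hgrad (p i) _ (hdrift i.castSucc)]

end Epoch

theorem gradient_mean {E : Type*} [NormedAddCommGroup E] [InnerProductSpace ℝ E]
    [CompleteSpace E] {n : ℕ} {f : Fin n → E → ℝ} (hf : ∀ i w, DifferentiableAt ℝ (f i) w) (c : ℝ)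
    (w : E) : gradient (fun w => c * ∑ i, f i w) w = c • ∑ i, gradient (f i) w := by
  have h1 : DifferentiableAt ℝ (fun w => ∑ i, f i w) w :=
    DifferentiableAt.fun_sum fun i _ => hf i w
  simp only [gradient]
  rw [fderiv_const_mul h1, fderiv_fun_sum fun i _ => hf i w, map_smulₛₗ, map_sum]
  simp

theorem stmt18 {d n K : ℕ} (hn2 : 2 ≤ n) (hneven : Even n) (hK : 1 ≤ K)
    (f : Fin n → EuclideanSpace ℝ (Fin d) → ℝ)
    (hdiff : ∀ i w, DifferentiableAt ℝ (f i) w)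
    (favg : EuclideanSpace ℝ (Fin d) → ℝ)
    (hfavg : ∀ w, favg w = (n : ℝ)⁻¹ * ∑ i, f i w)
    (fstar : ℝ) (hfstar : IsGLB (Set.range favg) fstar)
    (σ L : ℝ) (hσ : 0 < σ) (hL : 0 < L)
    (hnoise : ∀ i w, ‖gradient (f i) w - gradient favg w‖ ≤ σ)
    (hsmooth : ∀ i w v, ‖gradient (f i) w - gradient (f i) v‖ ≤ L * ‖w - v‖)
    (w1 : EuclideanSpace ℝ (Fin d))
    (η : Fin K → Fin n → ℝ) (hη : ∀ k i, η k i = 1 ∨ η k i = -1)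
    (π : Fin K → Equiv.Perm (Fin n))
    (α : ℝ)
    -- `W k i` is the iterate `w^{k,i}`; the epoch-`k` start point is `W k 0`
    (W : Fin K → Fin (n+1) → EuclideanSpace ℝ (Fin d))
    (hWinit : W ⟨0, hK⟩ 0 = w1)
    (hWstep : ∀ (k : Fin K) (i : Fin n),
      W k i.succ = W k i.castSucc - α • gradient (f (π k i)) (W k i.castSucc))
    (hWepoch : ∀ (k : Fin K) (h : (k : ℕ) + 1 < K), W ⟨(k : ℕ) + 1, h⟩ 0 = W k (Fin.last n))
    -- `X k i` is the stochastic gradient `x_i^k` encountered in epoch `k`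
    (X : Fin K → Fin n → EuclideanSpace ℝ (Fin d))
    (hX : ∀ k i, X k i = gradient (f (π k i)) (W k i.castSucc))
    -- `τ k` is the thinned-reordering permutation determined by the signs `η k`
    (τ : Fin K → Equiv.Perm (Fin n))
    (s : Fin K → ℕ) (hs : ∀ k, s k = Nat.card {i : Fin n // η k i = 1})
    (hτ_mem : ∀ k (a : Fin n), (a : ℕ) < s k ↔ η k (τ k a) = 1)
    (hτ_inc : ∀ k (a b : Fin n), (a : ℕ) < s k → (b : ℕ) < s k → (a < b ↔ τ k a < τ k b))
    (hτ_dec : ∀ k (a b : Fin n), s k ≤ (a : ℕ) → s k ≤ (b : ℕ) → (a < b ↔ τ k b < τ k a))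
    (hπ : ∀ (k : Fin K) (h : (k : ℕ) + 1 < K) (i : Fin n),
      π ⟨(k : ℕ) + 1, h⟩ i = π k (τ k i))
    -- prefix discrepancy bound for the thinning of each epoch's gradients
    (Atil : ℝ) (hAtil : 0 < Atil)
    (hdisc : ∀ k, (⨆ j : Fin n, ‖∑ i ∈ Finset.Iic j, η k i • X k i‖) ≤
      2 * Atil * ⨆ i, ‖X k i - (n : ℝ)⁻¹ • ∑ i', X k i'‖)
    (F1 : ℝ) (hF1 : F1 = favg w1 - fstar)
    (hα : α = min (1 / (16 * L * (2 * (n : ℝ) + Atil)))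
      ((4 * F1 / (42 * L^2 * σ^2 * Atil^2 * (n : ℝ) * (K : ℝ) +
        18 * L^2 * (n : ℝ)^3 * σ^2)) ^ ((1:ℝ)/3))) :
    (1/(K : ℝ)) * ∑ k : Fin K, ‖gradient favg (W k 0)‖^2 ≤
      9 * (F1 * L * σ * Atil) ^ ((2:ℝ)/3) / ((n : ℝ) * (K : ℝ)) ^ ((2:ℝ)/3) +
      ((72 * F1 * L * σ) ^ ((2:ℝ)/3) + 64 * F1 * L * (2 + Atil / (n : ℝ))) / (K : ℝ) := by
  have hn : 0 < n := by omega
  have hn' : (0 : ℝ) < n := Nat.cast_pos.2 hn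
  have hK' : (0 : ℝ) < K := Nat.cast_pos.2 hK
  have hGb : ∀ w, gradient favg w = (n : ℝ)⁻¹ • ∑ i, gradient (f i) w := fun w => by
    rw [funext hfavg]
    exact gradient_mean hdiff _ w
  have hfd : Differentiable ℝ favg := by
    rw [funext hfavg]
    exact fun w => (DifferentiableAt.fun_sum fun i _ => hdiff i w).const_mul _
  have hlip := lipschitz_mean hL.le hn hGb hsmooth
  have hfs : ∀ w, fstar ≤ favg w := fun w => hfstar.1 ⟨w, rfl⟩
  have hF0 : 0 ≤ F1 := by linarith [hfs w1]
  have hα0 : 0 ≤ α := by rw [hα]; positivity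
  have hstep : 16 * L * (2 * n + Atil) * α ≤ 1 := by
    have h1 : α ≤ 1 / (16 * L * (2 * n + Atil)) := hα ▸ min_le_left _ _
    rwa [le_div_iff₀ (by positivity), mul_comm] at h1
  -- `idx` extends the epochs to all natural numbers
  set idx : ℕ → Fin K := fun k => ⟨min k (K - 1), by omega⟩
  have hidx : ∀ k (hk : k < K), idx k = ⟨k, hk⟩ := fun k hk => by
    simp only [idx, Fin.mk.injEq]; omega
  set g : ℕ → ℝ := fun k => ‖gradient favg (W (idx k) 0)‖
  set Δ : ℕ → ℝ := fun k => epochDrift (W (idx k))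
  set P : ℕ → ℝ := fun k =>
    prefixDeviation (fun i => gradient (f i)) (gradient favg) (π (idx k)) (W (idx k) 0)
  have hnext : ∀ k, k + 1 < K → W (idx (k + 1)) 0 = W (idx k) (Fin.last n) := fun k hk => by
    rw [hidx (k + 1) hk, hidx k (by omega)]
    exact hWepoch ⟨k, by omega⟩ hk
  have hzero : W (idx 0) 0 = w1 := by rw [hidx 0 hK]; exact hWinit
  have hsumg : ∑ k : Fin K, ‖gradient favg (W k 0)‖ ^ 2 = ∑ k ∈ range K, g k ^ 2 := by
    rw [← Fin.sum_univ_eq_sum_range (fun k => g k ^ 2)]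
    exact sum_congr rfl fun k _ => by simp only [g, hidx k k.2]
  have hdrift := sum_sq_drift_le (K := K) hn'.le hAtil.le hL.le hα0 hstep (P := P) (g := g) (Δ := Δ)
    (σ := σ)
    (fun k => prefixDeviation_nonneg _ _ _ _) (fun k => norm_nonneg _)
    (fun k => epochDrift_nonneg _)
    (fun k _ => epochDrift_le hL.le hα0 hsmooth (π (idx k)) (hWstep (idx k)))
    (fun k hk => by
      simp only [P, g, Δ]
      rw [hnext k hk]
      refine prefixDeviation_thinned_reorder_le hL.le hAtil.le hn hGb hnoise hsmooth (W (idx k))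
        (hX _) (hη _) (hτ_mem _) (hτ_inc _) (hτ_dec _) (fun i => ?_) (hdisc _)
      rw [hidx (k + 1) hk, hidx k (by omega)]
      exact hπ ⟨k, by omega⟩ hk i)
    (prefixDeviation_le hσ.le hnoise _ _)
  have hθ : α * n * L ≤ 1 := by
    nlinarith [mul_nonneg (mul_nonneg hα0 hL.le) hAtil.le,
      mul_nonneg (mul_nonneg hα0 hL.le) hn'.le]
  have hdesc : ∀ k, favg (W (idx k) (Fin.last n)) ≤
      favg (W (idx k) 0) - α * n / 2 * g k ^ 2 + α * n / 2 * (L * Δ k) ^ 2 := fun k => by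
    have h1 := iterate_eq_sub_sum (hWstep (idx k)) (Fin.last n)
    rw [Fin.val_last, initialSegment_self] at h1
    have h2 := descent_of_inexact_gradient hfd hlip (W (idx k) 0) _ (by positivity) hθ
      (norm_mean_sub_le hL.le hn hGb hsmooth (π (idx k)) (W (idx k) 0)
        (fun i => W (idx k) i.castSucc) (epochDrift_nonneg _) fun i => by
          rw [norm_sub_rev]; exact norm_sub_le_epochDrift _ _)
    rwa [mul_smul, smul_inv_smul₀ hn'.ne', ← h1] at h2
  have htel : ∀ M, M < K → favg (W (idx M) (Fin.last n)) ≤ favg w1 -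
      α * n / 2 * ∑ k ∈ range (M + 1), g k ^ 2 +
      α * n / 2 * ∑ k ∈ range (M + 1), (L * Δ k) ^ 2 := by
    intro M
    induction M with
    | zero => intro _; simpa [hzero] using hdesc 0
    | succ M ih =>
      intro hM
      have h1 := ih (by omega)
      have h2 := hdesc (M + 1)
      rw [hnext M hM] at h2
      rw [sum_range_succ _ (M + 1), sum_range_succ _ (M + 1)]
      linarith
  have hmain := htel (K - 1) (by omega)
  rw [Nat.sub_add_cancel hK] at hmain
  rw [hsumg]
  rcases hF0.eq_or_lt with hF | hF
  · -- the initial point is a minimizer and the step size vanishes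
    have hαz : α = 0 := by
      refine le_antisymm ?_ hα0
      rw [hα, ← hF]
      refine (min_le_right _ _).trans_eq ?_
      rw [mul_zero, zero_div, Real.zero_rpow (by norm_num)]
    have hconst : ∀ k, k < K → W (idx k) 0 = w1 := by
      intro k
      induction k with
      | zero => exact fun _ => hzero
      | succ k ih =>
        intro hk
        rw [hnext k hk, iterate_eq_sub_sum (hWstep (idx k)), hαz, zero_smul, sub_zero,
          ih (by omega)]
    have hmin : IsLocalMin favg w1 := Filter.Eventually.of_forall fun w => by
      linarith [hfs w]
    have hgrad : gradient favg w1 = 0 := by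
      rw [gradient, hmin.fderiv_eq_zero, map_zero]
    have hsum0 : ∑ k ∈ range K, g k ^ 2 = 0 := sum_eq_zero fun k hk => by
      simp only [g, hconst k (mem_range.1 hk), hgrad, norm_zero]
      norm_num
    rw [hsum0, ← hF, mul_zero]
    positivity
  · refine rate_bound_of_step_size hn' hK' hF hL hσ hAtil hα ?_
    have hαpos : 0 < α := by rw [hα]; positivity
    have h1 : α * n / 2 * (∑ k ∈ range K, g k ^ 2 - ∑ k ∈ range K, (L * Δ k) ^ 2) ≤ F1 := by
      linarith [hfs (W (idx (K - 1)) (Fin.last n))]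
    have h2 : ∑ k ∈ range K, g k ^ 2 - ∑ k ∈ range K, (L * Δ k) ^ 2 ≤ 2 * (F1 / (α * n)) := by
      rw [← mul_div_assoc, le_div_iff₀ (by positivity)]
      linarith
    have h3 : 9 / 4 * F1 / (α * n) = 9 / 4 * (F1 / (α * n)) := by ring
    rw [h3]
    have h4 : 0 ≤ α ^ 2 * L ^ 2 * σ ^ 2 * (Atil ^ 2 * K) := by positivity
    have h5 : 0 ≤ α ^ 2 * L ^ 2 * σ ^ 2 * (n : ℝ) ^ 2 := by positivity
    linarith

end
end

section
/- Let X = {x_1, …, x_n}, let S_in ⊆ X be a fixed input set of size n_in, let S_out ⊆ S_in be a random output set of size n_out, and let w := p_in − q_out. Let K ∈ ℝ^{n×n} be symmetric positive semidefinite with eigenvalues λ_1 ≥ … ≥ λ_n and λ_{n+1} := 0, let ν > 0 and δ ∈ [0,1), and suppose there is an event E with P(E) ≥ 1 − δ/2 on which w is (K, ν)-sub-Gaussian. Define the shift a := ν·√e + min_{r ≤ n_in} { ν·e·√r + √( λ_{r+1}·(1/n_out − 1/n_in) ) } and the parameter v := ν·√e. Then for every t ≥ 0, P( E ∩ { √(wᵀ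 K w) ≥ a + v·√t } ) ≤ e^{−t}. -/
open MeasureTheory Matrix Finset

noncomputable section

/-- Probability vector of a finite index set: mass `1/|S|` on each element of `S`. -/
def probVec {n : ℕ} (S : Finset (Fin n)) : Fin n → ℝ :=
  fun i => if i ∈ S then ((S.card : ℝ))⁻¹ else 0

lemma integrable_exp_linear_sub_sq {b : ℝ} (hb : 0 < b) (z : ℝ) :
    Integrable (fun x : ℝ => Real.exp (x * z - b * x ^ 2)) ∧
      ∫ x : ℝ, Real.exp (x * z - b * x ^ 2) =
        √(Real.pi / b) * Real.exp (z ^ 2 / (4 * b)) := by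
  have hsq : (fun x : ℝ => Real.exp (x * z - b * x ^ 2)) =
      fun x => Real.exp (z ^ 2 / (4 * b)) * Real.exp (-b * (x - z / (2 * b)) ^ 2) := by
    funext x
    rw [← Real.exp_add]
    congr 1
    field_simp
    ring
  rw [hsq]
  refine ⟨((integrable_exp_neg_mul_sq hb).comp_sub_right (z / (2 * b))).const_mul _, ?_⟩
  rw [integral_const_mul,
    integral_sub_right_eq_self (fun x : ℝ => Real.exp (-b * x ^ 2)) (z / (2 * b)),
    integral_gaussian, mul_comm]

lemma lintegral_exp_linear_sub_sq {ι : Type*} [Fintype ι] {b : ℝ} (hb : 0 < b) (z : ι → ℝ) :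
    ∫⁻ g : ι → ℝ, ENNReal.ofReal (Real.exp (∑ i, g i * z i - b * ∑ i, g i ^ 2)) =
      ENNReal.ofReal (√(Real.pi / b) ^ Fintype.card ι *
        Real.exp ((∑ i, z i ^ 2) / (4 * b))) := by
  have hprod : ∀ g : ι → ℝ, Real.exp (∑ i, g i * z i - b * ∑ i, g i ^ 2) =
      ∏ i, Real.exp (g i * z i - b * g i ^ 2) := by
    intro g
    rw [← Real.exp_sum, Finset.sum_sub_distrib, Finset.mul_sum]
  simp_rw [hprod]
  rw [volume_pi, ← ofReal_integral_eq_lintegral_ofReal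
    (Integrable.fintype_prod (f := fun i (x : ℝ) => Real.exp (x * z i - b * x ^ 2))
      fun i => (integrable_exp_linear_sub_sq hb (z i)).1)
    (ae_of_all _ fun g => by positivity)]
  rw [integral_fintype_prod_eq_prod (fun i (x : ℝ) => Real.exp (x * z i - b * x ^ 2))]
  simp_rw [fun i => (integrable_exp_linear_sub_sq hb (z i)).2]
  rw [Finset.prod_mul_distrib, ← Real.exp_sum, Finset.prod_const, Finset.card_univ,
    Finset.sum_div]

/-- Tail bound for the squared Euclidean norm of a sub-Gaussian vector, obtained by integrating
the moment generating function against a Gaussian weight. -/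
lemma measure_sum_sq_ge_le_of_subGaussian {Ω ι : Type*} [MeasurableSpace Ω] [Fintype ι]
    (μ : Measure Ω) [SFinite μ] {Z : Ω → ι → ℝ} (hZ : Measurable Z) {ν : ℝ} (hν : 0 < ν)
    (hsub : ∀ g : ι → ℝ, ∫⁻ ω, ENNReal.ofReal (Real.exp (∑ i, g i * Z ω i)) ∂μ ≤
      ENNReal.ofReal (Real.exp (ν ^ 2 / 2 * ∑ i, g i ^ 2))) (t : ℝ) :
    μ {ω | 5 / 2 * ν ^ 2 * (t + Fintype.card ι) ≤ ∑ i, Z ω i ^ 2} ≤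
      ENNReal.ofReal (Real.exp (-t)) := by
  set r := Fintype.card ι with hr
  have hb : 0 < 5 / 8 * ν ^ 2 := by positivity
  have hb' : 0 < 1 / 8 * ν ^ 2 := by positivity
  set f : Ω → ENNReal := fun ω => ∫⁻ g : ι → ℝ, ENNReal.ofReal
    (Real.exp (∑ i, g i * Z ω i - 5 / 8 * ν ^ 2 * ∑ i, g i ^ 2)) with hf
  have hZi : ∀ i, Measurable fun ω => Z ω i := fun i => (measurable_pi_apply i).comp hZ
  have hmeas : Measurable (Function.uncurry fun (ω : Ω) (g : ι → ℝ) => ENNReal.ofReal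
      (Real.exp (∑ i, g i * Z ω i - 5 / 8 * ν ^ 2 * ∑ i, g i ^ 2))) := by
    simp only [Function.uncurry_def]
    fun_prop
  have hfval : ∀ ω, f ω = ENNReal.ofReal (√(Real.pi / (5 / 8 * ν ^ 2)) ^ r *
      Real.exp ((∑ i, Z ω i ^ 2) / (4 * (5 / 8 * ν ^ 2)))) := fun ω =>
    lintegral_exp_linear_sub_sq hb (Z ω)
  have hfint : ∫⁻ ω, f ω ∂μ ≤ ENNReal.ofReal (√(Real.pi / (1 / 8 * ν ^ 2)) ^ r) := by
    rw [hf, lintegral_lintegral_swap hmeas.aemeasurable]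
    have hval := lintegral_exp_linear_sub_sq hb' (0 : ι → ℝ)
    simp only [Pi.zero_apply, mul_zero, Finset.sum_const_zero, zero_sub, ne_eq,
      OfNat.ofNat_ne_zero, not_false_eq_true, zero_pow, zero_div, Real.exp_zero, mul_one] at hval
    rw [← hval]
    refine lintegral_mono fun g => ?_
    simp_rw [sub_eq_add_neg, Real.exp_add, ENNReal.ofReal_mul (Real.exp_pos _).le]
    rw [lintegral_mul_const _ (by fun_prop)]
    refine (mul_le_mul_left (hsub g) _).trans_eq ?_
    rw [← ENNReal.ofReal_mul (Real.exp_pos _).le, ← Real.exp_add]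
    congr 2
    ring
  have hmarkov := mul_meas_ge_le_lintegral (μ := μ) (f := f) hmeas.lintegral_prod_right
    (ENNReal.ofReal (√(Real.pi / (5 / 8 * ν ^ 2)) ^ r * Real.exp (t + r)))
  have hsubset : {ω | 5 / 2 * ν ^ 2 * (t + r) ≤ ∑ i, Z ω i ^ 2} ⊆
      {ω | ENNReal.ofReal (√(Real.pi / (5 / 8 * ν ^ 2)) ^ r * Real.exp (t + r)) ≤ f ω} := by
    intro ω hω
    simp only [Set.mem_ofPred_eq] at hω ⊢
    rw [hfval]
    gcongr
    rw [le_div_iff₀ (by positivity)]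
    linarith
  have hc : 0 < √(Real.pi / (5 / 8 * ν ^ 2)) := Real.sqrt_pos.mpr (by positivity)
  refine (measure_mono hsubset).trans ?_
  have hpos : 0 < √(Real.pi / (5 / 8 * ν ^ 2)) ^ r * Real.exp (t + r) := by positivity
  refine (ENNReal.mul_le_mul_iff_right (ENNReal.ofReal_pos.mpr hpos).ne'
    ENNReal.ofReal_ne_top).mp ((hmarkov.trans hfint).trans ?_)
  rw [← ENNReal.ofReal_mul hpos.le]
  apply ENNReal.ofReal_le_ofReal
  rw [mul_assoc, ← Real.exp_add, show t + (r : ℝ) + -t = r * 1 by ring, Real.exp_nat_mul,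
    ← mul_pow]
  gcongr
  rw [show Real.pi / (1 / 8 * ν ^ 2) = Real.pi / (5 / 8 * ν ^ 2) * 5 by field_simp,
    Real.sqrt_mul (by positivity)]
  gcongr
  rw [Real.sqrt_le_left (Real.exp_pos _).le]
  nlinarith [Real.exp_one_gt_d9]

section Spectral

variable {n : Type*} [Fintype n] [DecidableEq n] {K : Matrix n n ℝ} (hK : K.IsHermitian)

lemma dotProduct_mulVec_eq_sum_eigenvalues (x y : n → ℝ) :
    x ⬝ᵥ (K *ᵥ y) = ∑ i, hK.eigenvalues i *
      ((⇑(hK.eigenvectorBasis i) ⬝ᵥ x) * (⇑(hK.eigenvectorBasis i) ⬝ᵥ y)) := by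
  have h := hK.eigenvectorBasis.sum_inner_mul_inner (WithLp.toLp 2 x) (WithLp.toLp 2 (K *ᵥ y))
  simp only [EuclideanSpace.inner_eq_star_dotProduct, star_trivial] at h
  rw [dotProduct_comm, ← h]
  refine Finset.sum_congr rfl fun i _ => ?_
  have hsymm : (K *ᵥ y) ⬝ᵥ ⇑(hK.eigenvectorBasis i) =
      hK.eigenvalues i * (⇑(hK.eigenvectorBasis i) ⬝ᵥ y) := by
    rw [dotProduct_comm, dotProduct_mulVec, ← mulVec_transpose,
      show Kᵀ = K by simpa using hK.eq, hK.mulVec_eigenvectorBasis, smul_dotProduct, smul_eq_mul]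
  rw [hsymm]
  ring

lemma sum_eigenvectorBasis_dotProduct_sq (x : n → ℝ) :
    ∑ i, (⇑(hK.eigenvectorBasis i) ⬝ᵥ x) ^ 2 = x ⬝ᵥ x := by
  have h := hK.eigenvectorBasis.sum_inner_mul_inner (WithLp.toLp 2 x) (WithLp.toLp 2 x)
  simp only [EuclideanSpace.inner_eq_star_dotProduct, star_trivial] at h
  rw [← h]
  refine Finset.sum_congr rfl fun i _ => ?_
  rw [dotProduct_comm x]
  ring

lemma eigenvectorBasis_dotProduct_sum_smul (T : Finset n) (c : n → ℝ) (i : n) :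
    ⇑(hK.eigenvectorBasis i) ⬝ᵥ (∑ j ∈ T, c j • ⇑(hK.eigenvectorBasis j)) =
      if i ∈ T then c i else 0 := by
  have h : ∀ j, ⇑(hK.eigenvectorBasis i) ⬝ᵥ ⇑(hK.eigenvectorBasis j) =
      if i = j then 1 else 0 := by
    intro j
    have := orthonormal_iff_ite.mp hK.eigenvectorBasis.orthonormal i j
    rw [EuclideanSpace.inner_eq_star_dotProduct, star_trivial, dotProduct_comm] at this
    exact this
  simp [dotProduct_sum, h]

end Spectral

/-- Tail bound for the part of the quadratic form `wᵀ K w` carried by the eigenvectors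
indexed by `T`. -/
lemma measure_sum_eigenvalues_ge_le {Ω n : Type*} [MeasurableSpace Ω] [Fintype n] [DecidableEq n]
    (μ : Measure Ω) [SFinite μ] {w : Ω → n → ℝ} (hw : Measurable w) {K : Matrix n n ℝ}
    (hK : K.PosSemidef) {ν : ℝ} (hν : 0 < ν)
    (hsub : ∀ u : n → ℝ, ∫⁻ ω, ENNReal.ofReal (Real.exp (u ⬝ᵥ (K *ᵥ w ω))) ∂μ ≤
      ENNReal.ofReal (Real.exp (ν ^ 2 / 2 * (u ⬝ᵥ (K *ᵥ u))))) (T : Finset n) (t : ℝ) :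
    μ {ω | 5 / 2 * ν ^ 2 * (t + #T) ≤ ∑ i ∈ T, hK.isHermitian.eigenvalues i *
      (⇑(hK.isHermitian.eigenvectorBasis i) ⬝ᵥ w ω) ^ 2} ≤ ENNReal.ofReal (Real.exp (-t)) := by
  set l := hK.isHermitian.eigenvalues with hl
  have hl0 : ∀ i, 0 ≤ l i := hK.eigenvalues_nonneg
  set B : n → n → ℝ := fun i => ⇑(hK.isHermitian.eigenvectorBasis i) with hB
  have hZ : Measurable fun ω (i : T) => √(l i) * (B i ⬝ᵥ w ω) := by
    have : ∀ j, Measurable fun ω => w ω j := fun j => (measurable_pi_apply j).comp hw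
    simp only [dotProduct]
    fun_prop
  have key := measure_sum_sq_ge_le_of_subGaussian μ hZ hν (fun g => ?_) t
  · simp_rw [mul_pow, Real.sq_sqrt (hl0 _)] at key
    have hsum : ∀ ω, ∑ i : T, l i * (B i ⬝ᵥ w ω) ^ 2 = ∑ i ∈ T, l i * (B i ⬝ᵥ w ω) ^ 2 :=
      fun ω => Finset.sum_coe_sort T fun i => l i * (B i ⬝ᵥ w ω) ^ 2
    simpa only [Fintype.card_coe, hsum] using key
  · set c : n → ℝ := fun j => if h : j ∈ T then g ⟨j, h⟩ / √(l j) else 0 with hc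
    have hcT : ∀ i : T, c i = g i / √(l i) := fun i => by simp [hc]
    set u : n → ℝ := ∑ j ∈ T, c j • B j with hu
    have hBu : ∀ i, B i ⬝ᵥ u = if i ∈ T then c i else 0 :=
      eigenvectorBasis_dotProduct_sum_smul hK.isHermitian T c
    have hform : ∀ y, u ⬝ᵥ (K *ᵥ y) = ∑ i : T, l i * (c i * (B i ⬝ᵥ y)) := by
      intro y
      rw [dotProduct_mulVec_eq_sum_eigenvalues hK.isHermitian,
        Finset.sum_coe_sort T fun i => l i * (c i * (B i ⬝ᵥ y)),
        ← Finset.sum_subset (Finset.subset_univ T)]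
      · refine Finset.sum_congr rfl fun i hi => ?_
        rw [hBu, if_pos hi]
      · intro i _ hi
        rw [hBu, if_neg hi]
        simp
    have hmul : ∀ i : T, l i * c i = √(l i) * g i := by
      intro i
      rw [hcT]
      rcases (hl0 i).eq_or_lt with h | h
      · simp [← h]
      · have := Real.sqrt_pos.mpr h
        field_simp
        rw [Real.sq_sqrt h.le, mul_comm]
    have huu : u ⬝ᵥ (K *ᵥ u) ≤ ∑ i : T, g i ^ 2 := by
      rw [hform]
      refine Finset.sum_le_sum fun i _ => ?_
      rw [hBu, if_pos i.2, ← mul_assoc, hmul, hcT]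
      rcases (hl0 i).eq_or_lt with h | h
      · simp [← h, sq_nonneg]
      · have := Real.sqrt_pos.mpr h
        apply le_of_eq
        field_simp
    have huw : ∀ ω, u ⬝ᵥ (K *ᵥ w ω) = ∑ i : T, g i * (√(l i) * (B i ⬝ᵥ w ω)) := by
      intro ω
      rw [hform]
      refine Finset.sum_congr rfl fun i _ => ?_
      rw [← mul_assoc, hmul]
      ring
    have h := hsub u
    simp_rw [huw] at h
    refine h.trans (ENNReal.ofReal_le_ofReal (Real.exp_le_exp.mpr ?_))
    gcongr

lemma probVec_sub_dotProduct_self {n : ℕ} {S T : Finset (Fin n)} (hTS : T ⊆ S)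
    (hT : 0 < T.card) :
    (probVec S - probVec T) ⬝ᵥ (probVec S - probVec T) = 1 / (T.card : ℝ) - 1 / (S.card : ℝ) := by
  have hS : 0 < S.card := hT.trans_le (Finset.card_le_card hTS)
  have hterm : ∀ i, (probVec S - probVec T) i * (probVec S - probVec T) i =
      (if i ∈ S then ((S.card : ℝ)⁻¹) ^ 2 else 0) +
        (if i ∈ T then ((T.card : ℝ)⁻¹) ^ 2 - 2 * (S.card : ℝ)⁻¹ * (T.card : ℝ)⁻¹ else 0) := by
    intro i
    by_cases hiT : i ∈ T
    · simp only [Pi.sub_apply, probVec, hiT, hTS hiT, if_true]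
      ring
    · by_cases hiS : i ∈ S <;> simp [probVec, hiT, hiS, sq]
  simp only [dotProduct, hterm, Finset.sum_add_distrib, Finset.sum_ite_mem, Finset.univ_inter,
    Finset.sum_const, nsmul_eq_mul]
  have hS' : (S.card : ℝ) ≠ 0 := by positivity
  have hT' : (T.card : ℝ) ≠ 0 := by positivity
  field_simp
  ring

/-- A deterministic vector that is sub-Gaussian on an event of probability more than one half
has small kernel norm. -/
lemma dotProduct_mulVec_lt_of_const {n : ℕ} {K : Matrix (Fin n) (Fin n) ℝ} {p : Fin n → ℝ}
    {ν P : ℝ} (hν : 0 < ν) (hP : 1 / 2 < P)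
    (h : ∀ u : Fin n → ℝ, P * Real.exp (u ⬝ᵥ (K *ᵥ p)) ≤
      Real.exp (ν ^ 2 / 2 * (u ⬝ᵥ (K *ᵥ u)))) :
    p ⬝ᵥ (K *ᵥ p) < ν ^ 2 * Real.exp 1 := by
  by_contra! hge
  have hu := h ((ν ^ 2)⁻¹ • p)
  simp only [smul_dotProduct, mulVec_smul, dotProduct_smul, smul_eq_mul] at hu
  set m := p ⬝ᵥ (K *ᵥ p)
  have hm : Real.exp 1 ≤ (ν ^ 2)⁻¹ * m := by
    rw [inv_mul_eq_div, le_div_iff₀ (by positivity)]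
    linarith
  rw [show ν ^ 2 / 2 * ((ν ^ 2)⁻¹ * ((ν ^ 2)⁻¹ * m)) = (ν ^ 2)⁻¹ * m / 2 by field_simp] at hu
  set s := (ν ^ 2)⁻¹ * m
  have he := Real.exp_one_gt_d9
  have hs : Real.exp 1 ≤ Real.exp (s / 2) := Real.exp_le_exp.mpr (by linarith)
  rw [show s = s / 2 + s / 2 by ring, Real.exp_add, show s / 2 + s / 2 = s by ring] at hu
  nlinarith [mul_pos (Real.exp_pos (s / 2)) (Real.exp_pos (s / 2))]

lemma sqrt_add_le_add_sqrt {x y : ℝ} (hx : 0 ≤ x) (hy : 0 ≤ y) : √(x + y) ≤ √x + √y := by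
  rw [Real.sqrt_le_left (by positivity), add_sq, Real.sq_sqrt hx, Real.sq_sqrt hy]
  nlinarith [mul_nonneg (Real.sqrt_nonneg x) (Real.sqrt_nonneg y)]

theorem stmt19 {n : ℕ} {Ω : Type*} [MeasureSpace Ω]
    [IsProbabilityMeasure (volume : Measure Ω)]
    (Sin : Finset (Fin n)) (nin nout : ℕ) (hnin : Sin.card = nin)
    (Sout : Ω → Finset (Fin n)) (hsub : ∀ ω, Sout ω ⊆ Sin) (hcard : ∀ ω, (Sout ω).card = nout)
    (w : Ω → Fin n → ℝ) (hw : ∀ ω, w ω = probVec Sin - probVec (Sout ω))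
    (hmeasw : Measurable w)
    (K : Matrix (Fin n) (Fin n) ℝ) (hK : K.PosSemidef)
    -- `lam j` is the `(j+1)`-st largest eigenvalue of `K`, with `lam j = 0` for `j ≥ n`
    (lam : ℕ → ℝ) (hlam_sorted : Antitone lam) (hlam_zero : ∀ j, n ≤ j → lam j = 0)
    (hlam_eig : ∃ σ : Equiv.Perm (Fin n),
      ∀ i : Fin n, lam (i : ℕ) = hK.isHermitian.eigenvalues (σ i))
    (ν : ℝ) (hν : 0 < ν) (δ : ℝ) (hδ : δ ∈ Set.Ico (0:ℝ) 1)
    (E : Set Ω) (hE : MeasurableSet E) (hPE : 1 - δ/2 ≤ (volume E).toReal)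
    (hsubg : ∀ u : Fin n → ℝ,
      (∫ ω in E, Real.exp (u ⬝ᵥ (K *ᵥ w ω))) ≤ Real.exp (ν^2/2 * (u ⬝ᵥ (K *ᵥ u))))
    (a v : ℝ)
    (ha : a = ν * Real.sqrt (Real.exp 1) +
      (Finset.range (nin + 1)).inf' (Finset.nonempty_range_iff.mpr (Nat.succ_ne_zero nin))
        (fun r => ν * Real.exp 1 * Real.sqrt (r : ℝ) +
          Real.sqrt (lam r * (1/(nout : ℝ) - 1/(nin : ℝ)))))
    (hv : v = ν * Real.sqrt (Real.exp 1)) :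
    ∀ t ≥ (0:ℝ),
      volume (E ∩ {ω | a + v * Real.sqrt t ≤ Real.sqrt (w ω ⬝ᵥ (K *ᵥ w ω))}) ≤
        ENNReal.ofReal (Real.exp (-t)) := by
  intro t ht
  have hnonneg : ∀ r : ℕ, 0 ≤ ν * Real.exp 1 * √(r : ℝ) +
      √(lam r * (1 / (nout : ℝ) - 1 / (nin : ℝ))) := fun r => by positivity
  have he := Real.exp_one_gt_d9
  rcases Nat.eq_zero_or_pos nout with h0 | hpos
  · have hwc : ∀ ω, w ω = probVec Sin := by
      intro ω
      have hempty : Sout ω = ∅ := Finset.card_eq_zero.mp ((hcard ω).trans h0)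
      rw [hw ω, hempty]
      funext i
      simp [probVec]
    have hm : probVec Sin ⬝ᵥ (K *ᵥ probVec Sin) < ν ^ 2 * Real.exp 1 := by
      refine dotProduct_mulVec_lt_of_const (P := (volume E).toReal) hν
        (by linarith [hδ.2]) fun u => ?_
      have h := hsubg u
      simpa only [hwc, setIntegral_const, smul_eq_mul, Measure.real] using h
    have hempty : E ∩ {ω | a + v * √t ≤ √(w ω ⬝ᵥ (K *ᵥ w ω))} = ∅ := by
      refine Set.eq_empty_of_forall_notMem fun ω hω => ?_
      have hle : a + v * √t ≤ √(w ω ⬝ᵥ (K *ᵥ w ω)) := hω.2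
      have ha' : ν * √(Real.exp 1) ≤ a + v * √t := by
        have hinf := (Finset.le_inf'_iff
          (Finset.nonempty_range_iff.mpr (Nat.succ_ne_zero nin)) _).mpr fun r _ => hnonneg r
        have hvt : 0 ≤ v * √t := by rw [hv]; positivity
        rw [ha]
        linarith
      have hlt : √(w ω ⬝ᵥ (K *ᵥ w ω)) < ν * √(Real.exp 1) := by
        rw [hwc, Real.sqrt_lt' (by positivity), mul_pow, Real.sq_sqrt (Real.exp_pos 1).le]
        exact hm
      linarith
    rw [hempty]
    simp
  · have hsubg' : ∀ u : Fin n → ℝ,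
        ∫⁻ ω in E, ENNReal.ofReal (Real.exp (u ⬝ᵥ (K *ᵥ w ω))) ≤
          ENNReal.ofReal (Real.exp (ν ^ 2 / 2 * (u ⬝ᵥ (K *ᵥ u)))) := by
      intro u
      have hcont : Continuous fun y : Fin n → ℝ => Real.exp (u ⬝ᵥ (K *ᵥ y)) := by fun_prop
      have hint : Integrable (fun ω => Real.exp (u ⬝ᵥ (K *ᵥ w ω))) (volume.restrict E) := by
        refine Integrable.of_bound (hcont.measurable.comp hmeasw).aestronglyMeasurable
          (∑ S : Finset (Fin n), Real.exp (u ⬝ᵥ (K *ᵥ (probVec Sin - probVec S))))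
          (ae_of_all _ fun ω => ?_)
        rw [Real.norm_of_nonneg (Real.exp_pos _).le, hw ω]
        exact Finset.single_le_sum
          (f := fun S => Real.exp (u ⬝ᵥ (K *ᵥ (probVec Sin - probVec S))))
          (fun S _ => (Real.exp_pos _).le) (Finset.mem_univ (Sout ω))
      rw [← ofReal_integral_eq_lintegral_ofReal hint (ae_of_all _ fun ω => (Real.exp_pos _).le)]
      exact ENNReal.ofReal_le_ofReal (hsubg u)
    obtain ⟨r, -, hr⟩ := Finset.exists_mem_eq_inf'
      (Finset.nonempty_range_iff.mpr (Nat.succ_ne_zero nin))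
      (fun r : ℕ => ν * Real.exp 1 * √(r : ℝ) + √(lam r * (1 / (nout : ℝ) - 1 / (nin : ℝ))))
    rw [hr] at ha
    obtain ⟨σ, hσ⟩ := hlam_eig
    have hlam0 : ∀ j, 0 ≤ lam j := fun j =>
      (hlam_zero (max n j) (le_max_left _ _)).ge.trans (hlam_sorted (le_max_right _ _))
    set l := hK.isHermitian.eigenvalues with hl
    set B : Fin n → Fin n → ℝ := fun i => ⇑(hK.isHermitian.eigenvectorBasis i) with hB
    set T : Finset (Fin n) := {i | (σ.symm i : ℕ) < r} with hT
    have hTcard : #T ≤ r := by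
      calc #T = #({i : Fin n | (i : ℕ) < r} : Finset (Fin n)) :=
            Finset.card_equiv σ.symm (by simp [hT])
        _ ≤ r := by rw [Fin.card_filter_val_lt]; exact min_le_right _ _
    refine le_trans ?_ (measure_sum_eigenvalues_ge_le (volume.restrict E) hmeasw hK hν hsubg' T t)
    rw [Measure.restrict_apply' hE, Set.inter_comm]
    refine measure_mono (Set.inter_subset_inter_left _ fun ω hω => ?_)
    have hle : a + v * √t ≤ √(w ω ⬝ᵥ (K *ᵥ w ω)) := hω
    change 5 / 2 * ν ^ 2 * (t + #T) ≤ ∑ i ∈ T, l i * (B i ⬝ᵥ w ω) ^ 2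
    set A := ∑ i ∈ T, l i * (B i ⬝ᵥ w ω) ^ 2 with hA
    have hnorm : w ω ⬝ᵥ w ω = 1 / (nout : ℝ) - 1 / (nin : ℝ) := by
      rw [hw ω, probVec_sub_dotProduct_self (hsub ω) (by rw [hcard]; exact hpos), hcard, hnin]
    have hform : w ω ⬝ᵥ (K *ᵥ w ω) ≤ A + lam r * (1 / (nout : ℝ) - 1 / (nin : ℝ)) := by
      rw [dotProduct_mulVec_eq_sum_eigenvalues hK.isHermitian, ← hnorm,
        ← sum_eigenvectorBasis_dotProduct_sq hK.isHermitian, hA, Finset.mul_sum,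
        ← Finset.sum_add_sum_compl T]
      simp_rw [← sq]
      gcongr
      refine (Finset.sum_le_sum fun i hi => ?_).trans
        (Finset.sum_le_univ_sum_of_nonneg fun i => mul_nonneg (hlam0 r) (sq_nonneg _))
      have hi' : r ≤ (σ.symm i : ℕ) := by simpa [hT] using hi
      have hli : l i = lam (σ.symm i : ℕ) := by rw [hσ, Equiv.apply_symm_apply]
      have : l i ≤ lam r := hli ▸ hlam_sorted hi'
      gcongr
    have hA0 : 0 ≤ A := Finset.sum_nonneg fun i _ =>
      mul_nonneg (hK.eigenvalues_nonneg i) (sq_nonneg _)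
    have hsqrt : √(w ω ⬝ᵥ (K *ᵥ w ω)) ≤
        √A + √(lam r * (1 / (nout : ℝ) - 1 / (nin : ℝ))) :=
      (Real.sqrt_le_sqrt hform).trans (sqrt_add_le_add_sqrt hA0
        (mul_nonneg (hlam0 r) (hnorm ▸ Finset.sum_nonneg fun i _ => mul_self_nonneg (w ω i))))
    have hlow : ν * Real.exp 1 * √(r : ℝ) + ν * √(Real.exp 1) * √t ≤ √A := by
      have : 0 ≤ ν * √(Real.exp 1) := by positivity
      rw [ha, hv] at hle
      linarith
    have hsq : (ν * Real.exp 1 * √(r : ℝ) + ν * √(Real.exp 1) * √t) ^ 2 ≤ A := by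
      rw [← Real.sq_sqrt hA0]
      gcongr
    calc 5 / 2 * ν ^ 2 * (t + #T) ≤ 5 / 2 * ν ^ 2 * (t + r) := by gcongr
      _ ≤ ν ^ 2 * (Real.exp 1 ^ 2 * r + Real.exp 1 * t) := by
        have hr0 : (0 : ℝ) ≤ r := r.cast_nonneg
        have h1 : 5 / 2 * (r : ℝ) ≤ Real.exp 1 ^ 2 * r := by gcongr; nlinarith
        have h2 : 5 / 2 * t ≤ Real.exp 1 * t := by gcongr; linarith
        nlinarith [sq_nonneg ν]
      _ = (ν * Real.exp 1 * √(r : ℝ)) ^ 2 + (ν * √(Real.exp 1) * √t) ^ 2 := by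
        simp only [mul_pow, Real.sq_sqrt ht, Real.sq_sqrt (Nat.cast_nonneg r),
          Real.sq_sqrt (Real.exp_pos 1).le]
        ring
      _ ≤ (ν * Real.exp 1 * √(r : ℝ) + ν * √(Real.exp 1) * √t) ^ 2 := by
        have : 0 ≤ (ν * Real.exp 1 * √(r : ℝ)) * (ν * √(Real.exp 1) * √t) := by positivity
        linarith [add_sq (ν * Real.exp 1 * √(r : ℝ)) (ν * √(Real.exp 1) * √t)]
      _ ≤ A := hsq


end
end
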